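/- Let t* ≥ t0 and let C:[t*,∞)→ℝ be continuous, bounded and positive on (t*,∞) with C(t*)=0, and define q̃(t) = q for t ≤ t* and q̃(t) = q + C(t) for t > t*. Then the modified growth rate h̃_θ(t) = q̃(t)·k^t·|log k|/(η+k^t) is continuous on [t0,∞), and the modified Richards curve x̃_θ(t) = x_θ(t)·exp(∫_{t*}^{max(t,t*)} C(s)·k^s·|log k|/(η+k^s) ds) satisfies x̃_θ(t0) = x0 and d/dt x̃_θ(t) = h̃_θ(t)·x̃_θ(t) for every t ≥ t0. -/

import Mathlib

/-- The Richards growth curve solves `x' = q k^t |log k| / (η + k^t) x`. -/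
theorem hasDerivAt_richards (q x0 t0 : ℝ) {k η : ℝ} (hk0 : 0 < k) (hk1 : k < 1) (hη : 0 < η)
    (t : ℝ) :
    HasDerivAt (fun t : ℝ => x0 * ((η + k ^ t0) / (η + k ^ t)) ^ q)
      (q * k ^ t * |Real.log k| / (η + k ^ t) * (x0 * ((η + k ^ t0) / (η + k ^ t)) ^ q)) t := by
  have hA : 0 < η + k ^ t0 := by positivity
  have hB : 0 < η + k ^ t := by positivity
  have hpow : HasDerivAt (fun t : ℝ => k ^ t) (k ^ t * Real.log k) t :=
    (Real.hasStrictDerivAt_const_rpow hk0 t).hasDerivAt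
  have hquot := ((hasDerivAt_const t (η + k ^ t0)).fun_div (hpow.const_add η) hB.ne')
  have h := (hquot.rpow_const (p := q) (Or.inl (div_pos hA hB).ne')).const_mul x0
  refine h.congr_deriv ?_
  rw [Real.rpow_sub_one (div_pos hA hB).ne', abs_of_neg (Real.log_neg hk0 hk1)]
  field_simp
  ring

/-- A function on `[a, ∞)` vanishing at `a`, extended by its value at `a` to the left and weighted
by `w`, has the same primitive as the original one stopped at `a`. -/
theorem integral_max_eq_integral_comp_max {C : ℝ → ℝ} {a : ℝ} (hCa : C a = 0) (w : ℝ → ℝ) (t : ℝ) :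
    ∫ s in a..max t a, C s * w s = ∫ s in a..t, C (max s a) * w s := by
  rcases le_total a t with h | h
  · rw [max_eq_left h]
    refine intervalIntegral.integral_congr fun s hs => ?_
    rw [Set.uIcc_of_le h] at hs
    simp only [max_eq_left hs.1]
  · rw [max_eq_right h, intervalIntegral.integral_same]
    symm
    rw [intervalIntegral.integral_congr (g := fun _ => (0 : ℝ)) fun s hs => ?_,
      intervalIntegral.integral_zero]
    rw [Set.uIcc_of_ge h] at hs
    simp only [max_eq_right hs.2, hCa, zero_mul]

/-- Let `tstar ≥ t0` and let `C` be continuous, bounded and positive on `(tstar, ∞)` with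
`C tstar = 0`; define `qt t = q` for `t ≤ tstar` and `qt t = q + C t` for `t > tstar`. Then
the modified growth rate `ht t = qt t * k^t * |log k| / (η + k^t)` is continuous on
`[t0, ∞)`, and the modified Richards curve
`xt t = x t * exp(∫_{tstar}^{max t tstar} C s * k^s * |log k| / (η + k^s) ds)` satisfies
`xt t0 = x0` and `xt' t = ht t * xt t` for every `t ≥ t0`. -/
theorem stmt_10 (q k η x0 t0 tstar : ℝ) (hq : 0 < q) (hk0 : 0 < k) (hk1 : k < 1)
    (hη : 0 < η) (hx0 : 0 < x0) (htstar : t0 ≤ tstar)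
    (C : ℝ → ℝ)
    (hC_cont : ContinuousOn C (Set.Ici tstar))
    (hC_bdd : ∃ M : ℝ, ∀ t, tstar ≤ t → |C t| ≤ M)
    (hC_pos : ∀ t, tstar < t → 0 < C t)
    (hC_zero : C tstar = 0)
    (x qt ht xt : ℝ → ℝ)
    (hx : ∀ t, x t = x0 * ((η + k ^ t0) / (η + k ^ t)) ^ q)
    (hqt : ∀ t, qt t = if t ≤ tstar then q else q + C t)
    (hht : ∀ t, ht t = qt t * (k ^ t) * |Real.log k| / (η + k ^ t))
    (hxt : ∀ t, xt t =
      x t * Real.exp (∫ s in tstar..max t tstar, C s * (k ^ s) * |Real.log k| / (η + k ^ s))) :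
    ContinuousOn ht (Set.Ici t0) ∧
    xt t0 = x0 ∧
    ∀ t, t0 ≤ t → HasDerivAt xt (ht t * xt t) t := by
  have hden (t : ℝ) : 0 < η + k ^ t := by positivity
  have hpow : Continuous fun t : ℝ => k ^ t := Real.continuous_const_rpow hk0.ne'
  have hD : Continuous fun t => C (max t tstar) :=
    hC_cont.comp_continuous (by fun_prop) fun t => le_max_right t tstar
  have hw : Continuous fun t : ℝ => k ^ t * |Real.log k| / (η + k ^ t) :=
    (hpow.mul continuous_const).div (continuous_const.add hpow) fun t => (hden t).ne'
  have hqt' (t : ℝ) : qt t = q + C (max t tstar) := by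
    rw [hqt]
    split_ifs with h
    · rw [max_eq_right h, hC_zero, add_zero]
    · rw [max_eq_left (not_le.mp h).le]
  have hht' : ht = fun t => (q + C (max t tstar)) * (k ^ t * |Real.log k| / (η + k ^ t)) := by
    funext t
    rw [hht, hqt']
    ring
  have hxt' : xt = fun t => x0 * ((η + k ^ t0) / (η + k ^ t)) ^ q *
      Real.exp (∫ s in tstar..t, C (max s tstar) * (k ^ s * |Real.log k| / (η + k ^ s))) := by
    funext t
    rw [hxt, hx, ← integral_max_eq_integral_comp_max hC_zero
      (fun s => k ^ s * |Real.log k| / (η + k ^ s))]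
    simp only [mul_div_assoc, mul_assoc]
  refine ⟨?_, ?_, fun t _ => ?_⟩
  · rw [hht']
    exact ((continuous_const.add hD).mul hw).continuousOn
  · rw [hxt, hx, max_eq_right htstar, intervalIntegral.integral_same, div_self (hden t0).ne']
    simp
  · have hint := ((hD.mul hw).integral_hasStrictDerivAt tstar t).hasDerivAt
    rw [hxt', hht']
    refine ((hasDerivAt_richards q x0 t0 hk0 hk1 hη t).mul hint.exp).congr_deriv ?_
    simp only [Pi.mul_apply]
    ring
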